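/- There exists a real-analytic function V on the open set D = {(x,p) ∈ ℝ² : x < 0 and 0 < p < e^{x/2}} such that V(x,p) > 0 and c(x, V(x,p)) = p for all (x,p) ∈ D; that is, the implied volatility surface is real-analytic on D. -/

import Mathlib

open Real Set Filter

/-- The standard normal cumulative distribution function Φ. -/
noncomputable def stdNormalCDF (y : ℝ) : ℝ :=
  (Real.sqrt (2 * Real.pi))⁻¹ * ∫ t in Set.Iic y, Real.exp (-t ^ 2 / 2)

/-- The normalized Black-Scholes call price
`c(x,v) = e^{x/2} Φ(x/v + v/2) − e^{−x/2} Φ(x/v − v/2)`. -/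
noncomputable def normCall (x v : ℝ) : ℝ :=
  Real.exp (x / 2) * stdNormalCDF (x / v + v / 2) -
    Real.exp (-x / 2) * stdNormalCDF (x / v - v / 2)

open scoped Topology ContDiff

theorem integrable_exp_neg_sq_div_two :
    MeasureTheory.Integrable (fun t : ℝ => Real.exp (-t ^ 2 / 2)) := by
  convert integrable_exp_neg_mul_sq (b := 1 / 2) (by norm_num) using 3
  ring

/-- `Φ` is the distribution function of the standard Gaussian measure. -/
theorem stdNormalCDF_eq_cdf :
    stdNormalCDF = ProbabilityTheory.cdf (ProbabilityTheory.gaussianReal 0 1) := by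
  ext y
  rw [ProbabilityTheory.cdf_eq_real, MeasureTheory.measureReal_def,
    ProbabilityTheory.gaussianReal_apply_eq_integral 0 one_ne_zero, ENNReal.toReal_ofReal
      (MeasureTheory.integral_nonneg fun _ => ProbabilityTheory.gaussianPDFReal_nonneg _ _ _),
    stdNormalCDF, ← MeasureTheory.integral_const_mul]
  simp [ProbabilityTheory.gaussianPDFReal]

theorem hasDerivAt_stdNormalCDF (y : ℝ) :
    HasDerivAt stdNormalCDF ((Real.sqrt (2 * Real.pi))⁻¹ * Real.exp (-y ^ 2 / 2)) y := by
  have hI := integrable_exp_neg_sq_div_two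
  have hc : Continuous fun t : ℝ => Real.exp (-t ^ 2 / 2) := by fun_prop
  have h : stdNormalCDF = fun y => (Real.sqrt (2 * Real.pi))⁻¹ *
      ((∫ t in Set.Iic 0, Real.exp (-t ^ 2 / 2)) + ∫ t in (0 : ℝ)..y, Real.exp (-t ^ 2 / 2)) := by
    ext y
    rw [← intervalIntegral.integral_Iic_sub_Iic hI.integrableOn hI.integrableOn, stdNormalCDF]
    ring
  rw [h]
  exact ((hc.integral_hasStrictDerivAt 0 y).hasDerivAt.const_add _).const_mul _

/-- A function on `ℝ` whose derivative is the restriction of an entire function `g` is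
real-analytic. -/
theorem contDiff_omega_of_hasDerivAt_re {f : ℝ → ℝ} {g : ℂ → ℂ} (hg : Differentiable ℂ g)
    (hf : ∀ x : ℝ, HasDerivAt f (g x).re x) : ContDiff ℝ ω f := by
  obtain ⟨G, hG⟩ := hg.isExactOn_univ
  have hG' : ∀ z, HasDerivAt G (g z) z := fun z => hG z (mem_univ z)
  have hGd : Differentiable ℂ G := fun z => (hG' z).differentiableAt
  have hre : ContDiff ℝ ω fun x : ℝ => (G x).re := hGd.contDiff.real_of_complex
  have hfG : ∀ x : ℝ, HasDerivAt (fun x : ℝ => f x - (G x).re) 0 x := fun x => by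
    simpa using (hf x).fun_sub (hG' x).real_of_complex
  have hconst : f = fun x : ℝ => (G x).re + (f 0 - (G (0 : ℝ)).re) := by
    ext x
    have := is_const_of_deriv_eq_zero (fun x => (hfG x).differentiableAt)
      (fun x => (hfG x).deriv) x 0
    linarith
  rw [hconst]
  exact hre.add contDiff_const

theorem contDiff_stdNormalCDF : ContDiff ℝ ω stdNormalCDF := by
  refine contDiff_omega_of_hasDerivAt_re
    (g := fun z => ((Real.sqrt (2 * Real.pi))⁻¹ : ℝ) * Complex.exp (-z ^ 2 / 2)) (by fun_prop) ?_
  intro x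
  convert hasDerivAt_stdNormalCDF x using 1
  rw [Complex.re_ofReal_mul]
  congr 1
  rw [← Complex.exp_ofReal_re]
  push_cast
  rfl

theorem contDiffAt_normCall {q : ℝ × ℝ} (hq : q.2 ≠ 0) :
    ContDiffAt ℝ ω (fun q : ℝ × ℝ => normCall q.1 q.2) q := by
  have hdiv : ContDiffAt ℝ ω (fun q : ℝ × ℝ => q.1 / q.2) q := contDiffAt_fst.div contDiffAt_snd hq
  unfold normCall
  refine ContDiffAt.sub (ContDiffAt.mul (by fun_prop) ?_) (ContDiffAt.mul (by fun_prop) ?_)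
  · exact contDiff_stdNormalCDF.contDiffAt.comp q
      (hdiv.add (contDiffAt_snd.div_const 2))
  · exact contDiff_stdNormalCDF.contDiffAt.comp q
      (hdiv.sub (contDiffAt_snd.div_const 2))

/-- The Black–Scholes vega. -/
theorem hasDerivAt_normCall (x : ℝ) {v : ℝ} (hv : v ≠ 0) :
    HasDerivAt (normCall x) (Real.exp (x / 2) *
      ((Real.sqrt (2 * Real.pi))⁻¹ * Real.exp (-(x / v + v / 2) ^ 2 / 2))) v := by
  have hd : HasDerivAt (fun v => x / v) (-x / v ^ 2) v := by
    simpa using (hasDerivAt_const v x).fun_div (hasDerivAt_id v) hv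
  have hhalf : HasDerivAt (fun v : ℝ => v / 2) (1 / 2) v := (hasDerivAt_id v).div_const 2
  have h1 := ((hasDerivAt_stdNormalCDF (x / v + v / 2)).comp v (hd.add hhalf)).const_mul
    (Real.exp (x / 2))
  have h2 := ((hasDerivAt_stdNormalCDF (x / v - v / 2)).comp v (hd.sub hhalf)).const_mul
    (Real.exp (-x / 2))
  refine (h1.sub h2).congr_deriv ?_
  have key : Real.exp (-x / 2) * Real.exp (-(x / v - v / 2) ^ 2 / 2) =
      Real.exp (x / 2) * Real.exp (-(x / v + v / 2) ^ 2 / 2) := by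
    rw [← Real.exp_add, ← Real.exp_add]
    congr 1
    field_simp
    ring
  linear_combination (-(Real.sqrt (2 * Real.pi))⁻¹ * (-x / v ^ 2 - 1 / 2)) * key

theorem vega_pos (x y : ℝ) :
    0 < Real.exp (x / 2) * ((Real.sqrt (2 * Real.pi))⁻¹ * Real.exp (-y ^ 2 / 2)) := by
  positivity

theorem strictMonoOn_normCall (x : ℝ) : StrictMonoOn (normCall x) (Ioi 0) := by
  refine strictMonoOn_of_deriv_pos (convex_Ioi 0) (fun v hv =>
    (hasDerivAt_normCall x (ne_of_gt hv)).continuousAt.continuousWithinAt) fun v hv => ?_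
  rw [interior_Ioi] at hv
  rw [(hasDerivAt_normCall x (ne_of_gt hv)).deriv]
  exact vega_pos _ _

theorem tendsto_stdNormalCDF_atTop : Tendsto stdNormalCDF atTop (𝓝 1) := by
  rw [stdNormalCDF_eq_cdf]
  exact ProbabilityTheory.tendsto_cdf_atTop _

theorem tendsto_stdNormalCDF_atBot : Tendsto stdNormalCDF atBot (𝓝 0) := by
  rw [stdNormalCDF_eq_cdf]
  exact ProbabilityTheory.tendsto_cdf_atBot _

theorem tendsto_normCall_zero {x : ℝ} (hx : x < 0) :
    Tendsto (normCall x) (𝓝[>] 0) (𝓝 0) := by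
  have hdiv : Tendsto (fun v : ℝ => x / v) (𝓝[>] 0) atBot := by
    simpa only [div_eq_mul_inv] using tendsto_inv_nhdsGT_zero.const_mul_atTop_of_neg hx
  have hhalf : Tendsto (fun v : ℝ => v / 2) (𝓝[>] 0) (𝓝 (0 / 2)) :=
    tendsto_nhdsWithin_of_tendsto_nhds ((continuous_id.div_const (2 : ℝ)).tendsto 0)
  have h1 := (tendsto_stdNormalCDF_atBot.comp (hdiv.atBot_add hhalf)).const_mul (Real.exp (x / 2))
  have h2 := (tendsto_stdNormalCDF_atBot.comp (hdiv.atBot_add hhalf.neg)).const_mul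
    (Real.exp (-x / 2))
  simpa [normCall, Function.comp_def, sub_eq_add_neg] using! h1.sub h2

theorem tendsto_normCall_atTop (x : ℝ) :
    Tendsto (normCall x) atTop (𝓝 (Real.exp (x / 2))) := by
  have hdiv : Tendsto (fun v : ℝ => x / v) atTop (𝓝 0) := tendsto_id.const_div_atTop x
  have hhalf : Tendsto (fun v : ℝ => v / 2) atTop atTop := tendsto_id.atTop_div_const two_pos
  have h1 := (tendsto_stdNormalCDF_atTop.comp (hdiv.add_atTop hhalf)).const_mul (Real.exp (x / 2))
  have h2 := (tendsto_stdNormalCDF_atBot.comp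
    (hdiv.add_atBot (tendsto_neg_atTop_atBot.comp hhalf))).const_mul (Real.exp (-x / 2))
  simpa [normCall, Function.comp_def, sub_eq_add_neg] using! h1.sub h2

theorem exists_normCall_eq {x p : ℝ} (hx : x < 0) (hp : 0 < p) (hpx : p < Real.exp (x / 2)) :
    ∃ v, 0 < v ∧ normCall x v = p :=
  isPreconnected_Ioi.intermediate_value_Ioo (l₁ := 𝓝[>] 0) inf_le_right
    (le_principal_iff.2 (Ioi_mem_atTop 0))
    (fun _ hv => (hasDerivAt_normCall x (ne_of_gt hv)).continuousAt.continuousWithinAt)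
    (tendsto_normCall_zero hx) (tendsto_normCall_atTop x) ⟨hp, hpx⟩

/-- A positive solution `V` of `c(x, V(x,p)) = p` near a point is real-analytic there. -/
theorem analyticAt_of_eventually_normCall_eq {V : ℝ × ℝ → ℝ} {q : ℝ × ℝ}
    (hV : ∀ᶠ r in 𝓝 q, 0 < V r ∧ normCall r.1 (V r) = r.2) : AnalyticAt ℝ V q := by
  obtain ⟨hpos, hq⟩ := hV.self_of_nhds
  set f : (ℝ × ℝ) × ℝ → ℝ := fun u => normCall u.1.1 u.2 - u.1.2 with hf
  have hcd : ContDiffAt ℝ ω f (q, V q) := by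
    refine ContDiffAt.sub ?_ (by fun_prop)
    exact (contDiffAt_normCall (q := (q.1, V q)) hpos.ne').comp (q, V q)
      (f := fun u : (ℝ × ℝ) × ℝ => (u.1.1, u.2)) (by fun_prop)
  have hω : (ω : ℕ∞ω) ≠ 0 := by simp
  have hinv : (fderiv ℝ f (q, V q) ∘L .inr ℝ (ℝ × ℝ) ℝ).IsInvertible := by
    set L := fderiv ℝ f (q, V q) ∘L .inr ℝ (ℝ × ℝ) ℝ
    have hLd : HasDerivAt (fun v => f (q, v)) (L 1) (V q) := by
      have h1 : HasFDerivAt f (fderiv ℝ f (q, V q)) (q, V q) :=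
        (hcd.differentiableAt hω).hasFDerivAt
      exact (h1.comp (V q) (hasFDerivAt_prodMk_right q (V q))).hasDerivAt
    have hL1 : L 1 ≠ 0 := by
      rw [hLd.unique ((hasDerivAt_normCall q.1 hpos.ne').sub_const q.2)]
      exact (vega_pos _ _).ne'
    refine ⟨ContinuousLinearEquiv.unitsEquivAut ℝ (Units.mk0 (L 1) hL1), ?_⟩
    ext
    simp
  have han := hcd.contDiffAt_implicitFunction hω hinv
  set ψ := hcd.implicitFunction hω hinv
  have hψq : ψ q = V q := hcd.implicitFunction_apply_self hω hinv
  have hψpos : ∀ᶠ r in 𝓝 q, 0 < ψ r :=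
    han.continuousAt.eventually_mem (Ioi_mem_nhds (by rwa [hψq]))
  refine han.analyticAt.congr ?_
  filter_upwards [hψpos, hV, hcd.eventually_apply_implicitFunction hω hinv] with r h1 h2 h3
  refine (strictMonoOn_normCall r.1).injOn h1 h2.1 ?_
  simp only [hf, hq, sub_self] at h3
  rw [h2.2]
  exact sub_eq_zero.1 h3

/-- The implied volatility surface is real-analytic: there is a real-analytic function
`V` on `D = {(x,p) : x < 0, 0 < p < e^{x/2}}` with `V(x,p) > 0` and `c(x, V(x,p)) = p`
on `D`. -/
theorem impliedVol_analytic :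
    ∃ V : ℝ → ℝ → ℝ,
      AnalyticOnNhd ℝ (fun q : ℝ × ℝ => V q.1 q.2)
        {q : ℝ × ℝ | q.1 < 0 ∧ 0 < q.2 ∧ q.2 < Real.exp (q.1 / 2)} ∧
      ∀ q : ℝ × ℝ, q.1 < 0 → 0 < q.2 → q.2 < Real.exp (q.1 / 2) →
        0 < V q.1 q.2 ∧ normCall q.1 (V q.1 q.2) = q.2 := by
  have hex : ∀ q : ℝ × ℝ, ∃ v, q.1 < 0 → 0 < q.2 → q.2 < Real.exp (q.1 / 2) →
      0 < v ∧ normCall q.1 v = q.2 := fun q => by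
    by_cases h : q.1 < 0 ∧ 0 < q.2 ∧ q.2 < Real.exp (q.1 / 2)
    · obtain ⟨v, hv⟩ := exists_normCall_eq h.1 h.2.1 h.2.2
      exact ⟨v, fun _ _ _ => hv⟩
    · exact ⟨0, fun h1 h2 h3 => absurd ⟨h1, h2, h3⟩ h⟩
  choose V hV using hex
  refine ⟨fun x p => V (x, p), fun q hq => ?_, hV⟩
  have hopen : IsOpen {q : ℝ × ℝ | q.1 < 0 ∧ 0 < q.2 ∧ q.2 < Real.exp (q.1 / 2)} :=
    (isOpen_lt continuous_fst continuous_const).inter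
      ((isOpen_lt continuous_const continuous_snd).inter
        (isOpen_lt continuous_snd (continuous_fst.div_const 2).rexp))
  refine analyticAt_of_eventually_normCall_eq ?_
  filter_upwards [hopen.mem_nhds hq] with r hr using hV r hr.1 hr.2.1 hr.2.2
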